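/- arXiv:1707.08734 — 2 statements merged into one kernel-verified Lean document; each statement's English description precedes it below -/
import Mathlib

section
/- (Pair-Epistemic Stuttering) Suppose σ = σ₁.σ₂.σ₃ and τ = σ₁.σ₃ are call sequences such that Ṽ(σ₁) = Ṽ(σ₁.σ₂) (i.e., σ₂ is pair-epistemically redundant in σ). Then Ṽ(σ) = Ṽ(τ). -/
namespace Gossip

/-- A call between two distinct agents. -/
structure Call (A : Type) where
  x : A
  y : A
  ne : x ≠ y

variable {A : Type} [DecidableEq A]

/-- Agent `a` is involved in the call `c`. -/
def Call.involves (c : Call A) (a : A) : Prop := a = c.x ∨ a = c.y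

instance (c : Call A) (a : A) : Decidable (c.involves a) := by
  unfold Call.involves; infer_instance

/-- `c` is the call between agents `a` and `b`. -/
def Call.isBetween (c : Call A) (a b : A) : Prop :=
  (c.x = a ∧ c.y = b) ∨ (c.x = b ∧ c.y = a)

instance (c : Call A) (a b : A) : Decidable (c.isBetween a b) := by
  unfold Call.isBetween; infer_instance

/-- The effect of a call on a gossip situation: the two agents involved
pool their secrets. -/
def Call.apply (c : Call A) (s : A → Finset A) : A → Finset A :=
  fun d => if d = c.x ∨ d = c.y then s c.x ∪ s c.y else s d

/-- The initial gossip situation: each agent is familiar only with their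
own secret (secrets are identified with agents via the fixed bijection). -/
def root : A → Finset A := fun a => {a}

/-- The result of applying a call sequence to a gossip situation. -/
def applySeq (σ : List (Call A)) (s : A → Finset A) : A → Finset A :=
  σ.foldl (fun t c => c.apply t) s

/-- `∼_a` : the smallest relation with `ε ∼_a ε`, closed under appending
calls not involving `a` on either side, and under appending a call
involving `a` on both sides when it yields the same set of secrets for `a`. -/
inductive AgEquiv (a : A) : List (Call A) → List (Call A) → Prop
  | nil : AgEquiv a [] []
  | extLeft {σ τ : List (Call A)} (c : Call A) :
      ¬ c.involves a → AgEquiv a σ τ → AgEquiv a (σ ++ [c]) τ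
  | extRight {σ τ : List (Call A)} (c : Call A) :
      ¬ c.involves a → AgEquiv a σ τ → AgEquiv a σ (τ ++ [c])
  | call {σ τ : List (Call A)} (c : Call A) :
      c.involves a →
      applySeq (σ ++ [c]) root a = applySeq (τ ++ [c]) root a →
      AgEquiv a σ τ → AgEquiv a (σ ++ [c]) (τ ++ [c])

/-- `∼_G` : reflexive-transitive closure of the union of the `∼_a`, `a ∈ G`. -/
def GEquiv (G : Finset A) : List (Call A) → List (Call A) → Prop :=
  Relation.ReflTransGen (fun σ τ => ∃ a ∈ G, AgEquiv a σ τ)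

/-- Formulas of the language `L^ck`. `fam a p` is `F_a p`,
`ck G φ` is `C_G φ`; `K_a φ` is `ck {a} φ`. -/
inductive Formula (A : Type) where
  | fam : A → A → Formula A
  | neg : Formula A → Formula A
  | conj : Formula A → Formula A → Formula A
  | ck : Finset A → Formula A → Formula A

/-- Truth of a formula at a call sequence (in the gossip model). -/
def Sat : Formula A → List (Call A) → Prop
  | .fam a p, σ => p ∈ applySeq σ root a
  | .neg φ, σ => ¬ Sat φ σ
  | .conj φ ψ, σ => Sat φ σ ∧ Sat ψ σ
  | .ck G φ, σ => ∀ τ, GEquiv G σ τ → Sat φ τ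

/-- `M ⊨ φ` : truth at every call sequence. -/
def Truth (φ : Formula A) : Prop := ∀ σ : List (Call A), Sat φ σ

/-- Formulas with no occurrence of the negation symbol. -/
def NegFree : Formula A → Prop
  | .fam _ _ => True
  | .neg _ => False
  | .conj φ ψ => NegFree φ ∧ NegFree ψ
  | .ck _ φ => NegFree φ

/-- Formulas with no occurrence of the `C_G` modalities (propositional part). -/
def CkFree : Formula A → Prop
  | .fam _ _ => True
  | .neg φ => CkFree φ
  | .conj φ ψ => CkFree φ ∧ CkFree ψ
  | .ck _ _ => False

/-- Formulas of `L_wn`: no nested occurrence of the `C_G` modalities. -/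
def NoNested : Formula A → Prop
  | .fam _ _ => True
  | .neg φ => NoNested φ
  | .conj φ ψ => NoNested φ ∧ NoNested ψ
  | .ck _ φ => CkFree φ

/-- The call `ab` occurs in `σ`. -/
def occursBetween (a b : A) (σ : List (Call A)) : Prop :=
  ∃ c ∈ σ, c.isBetween a b

/-- Epistemic pair-view component `Ṽ(σ)(a,b)`. -/
def pairView (σ : List (Call A)) (a b : A) : Set (A → Finset A) :=
  {s | ∃ τ, GEquiv {a, b} σ τ ∧ s = applySeq τ root}

/-- The full epistemic pair-view `Ṽ(σ)` : all components `Ṽ(σ)(a,b)`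
together with the designated situation `Ṽ(σ)(*) = σ(root)`. -/
def fullView (σ : List (Call A)) : (A → A → Set (A → Finset A)) × (A → Finset A) :=
  (pairView σ, applySeq σ root)

/-- A call sequence is pair-epistemically non-redundant if no nonempty
subsequence `σ₂` of a prefix `σ₁.σ₂` is pair-epistemically redundant. -/
def PairNonRedundant (σ : List (Call A)) : Prop :=
  ∀ σ₁ σ₂ : List (Call A), (σ₁ ++ σ₂) <+: σ → σ₂ ≠ [] →
    fullView σ₁ ≠ fullView (σ₁ ++ σ₂)

/-- Order on gossip situations: componentwise inclusion. -/
def gsLE (s t : A → Finset A) : Prop := ∀ a, s a ⊆ t a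

/-- The order `≤_EPV` on (the pair components of) epistemic pair-views. -/
def epvLE (V W : A → A → Set (A → Finset A)) : Prop :=
  ∀ a b : A, ∃ X : Set (A → Finset A), X ⊆ V a b ∧
    ∃ g : X → W a b, Function.Surjective g ∧ ∀ s : X, gsLE s.1 (g s).1

/-- `σ` is ab-redundant free: no call of `σ` different from the call `ab`
is redundant (leaves the current gossip situation unchanged). -/
def abRedundantFree (a b : A) (σ : List (Call A)) : Prop :=
  ∀ (i : ℕ) (h : i < σ.length), ¬ (σ.get ⟨i, h⟩).isBetween a b →
    (σ.get ⟨i, h⟩).apply (applySeq (σ.take i) root) ≠ applySeq (σ.take i) root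

set_option linter.unusedSectionVars false

/-! ### Propagation of secrets -/

section Propagation

variable {c : Call A} {l : List (Call A)} {s t : A → Finset A} {d e : A} {U : Finset A}

lemma Call.apply_of_not_involves (h : ¬ c.involves e) : c.apply s e = s e := if_neg h

lemma Call.apply_of_involves (h : c.involves e) : c.apply s e = s c.x ∪ s c.y := if_pos h

lemma Call.involves_x (c : Call A) : c.involves c.x := Or.inl rfl

lemma Call.involves_y (c : Call A) : c.involves c.y := Or.inr rfl

lemma Call.isBetween.symm {a b : A} (h : c.isBetween a b) : c.isBetween b a := Or.symm h

lemma Call.isBetween.left {a b : A} (h : c.isBetween a b) : c.involves a := by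
  rcases h with ⟨h, -⟩ | ⟨-, h⟩
  · exact Or.inl h.symm
  · exact Or.inr h.symm

lemma Call.isBetween.right {a b : A} (h : c.isBetween a b) : c.involves b := h.symm.left

lemma Call.isBetween_of_involves {a b : A} (hab : a ≠ b) (ha : c.involves a)
    (hb : c.involves b) : c.isBetween a b := by
  unfold Call.involves at ha hb
  unfold Call.isBetween
  grind

lemma Call.isBetween.apply {a b : A} (h : c.isBetween a b) (s : A → Finset A) :
    c.apply s a = s a ∪ s b := by
  rw [Call.apply_of_involves h.left]
  rcases h with ⟨rfl, rfl⟩ | ⟨rfl, rfl⟩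
  · rfl
  · exact Finset.union_comm _ _

@[simp] lemma applySeq_nil : applySeq [] s = s := rfl

@[simp] lemma applySeq_cons : applySeq (c :: l) s = applySeq l (c.apply s) := rfl

@[simp] lemma applySeq_append (l m : List (Call A)) :
    applySeq (l ++ m) s = applySeq m (applySeq l s) := List.foldl_append

lemma Call.subset_apply (c : Call A) (s : A → Finset A) (e : A) : s e ⊆ c.apply s e := by
  unfold Call.apply
  split_ifs with h
  · rcases h with rfl | rfl
    · exact Finset.subset_union_left
    · exact Finset.subset_union_right
  · exact subset_rfl

lemma subset_applySeq (l : List (Call A)) (s : A → Finset A) (e : A) :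
    s e ⊆ applySeq l s e := by
  induction l generalizing s with
  | nil => exact subset_rfl
  | cons c l ih => exact (c.subset_apply s e).trans (ih _)

lemma self_mem_applySeq (l : List (Call A)) (e : A) : e ∈ applySeq l root e :=
  subset_applySeq l root e (Finset.mem_singleton_self e)

lemma applySeq_mono (l : List (Call A)) (h : ∀ e, s e ⊆ t e) :
    ∀ e, applySeq l s e ⊆ applySeq l t e := by
  induction l generalizing s t with
  | nil => exact h
  | cons c l ih =>
    refine ih fun e => (?_ : c.apply s e ⊆ c.apply t e)
    unfold Call.apply
    split_ifs
    · exact Finset.union_subset_union (h _) (h _)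
    · exact h e

lemma applySeq_of_not_involves (h : ∀ c ∈ l, ¬ c.involves e) : applySeq l s e = s e := by
  induction l generalizing s with
  | nil => rfl
  | cons c l ih =>
    rw [applySeq_cons, ih fun c' hc' => h c' (List.mem_cons_of_mem _ hc'),
      Call.apply_of_not_involves (h c List.mem_cons_self)]

lemma subset_applySeq_of_mem (hc : c ∈ l) (hd : c.involves d) (he : c.involves e) :
    s d ⊆ applySeq l s e := by
  induction l generalizing s with
  | nil => simp at hc
  | cons c' l ih =>
    rcases List.mem_cons.1 hc with rfl | hc
    · refine subset_trans ?_ (subset_applySeq l _ e)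
      change s d ⊆ c.apply s e
      rw [Call.apply_of_involves he]
      rcases hd with rfl | rfl
      · exact Finset.subset_union_left
      · exact Finset.subset_union_right
    · exact (c'.subset_apply s d).trans (ih hc)

lemma notMem_applySeq_of_not_involves (h : ∀ c ∈ l, ¬ c.involves e)
    (hs : ∀ d, d ≠ e → e ∉ s d) : ∀ d, d ≠ e → e ∉ applySeq l s d := by
  induction l generalizing s with
  | nil => exact hs
  | cons c l ih =>
    refine ih (fun c' hc' => h c' (List.mem_cons_of_mem _ hc')) fun d hd => ?_
    have hc := h c List.mem_cons_self
    unfold Call.involves at hc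
    unfold Call.apply
    have := hs c.x
    have := hs c.y
    have := hs d
    grind

/-- All calls of `l` are between agents of `U`. -/
def Within (U : Finset A) (l : List (Call A)) : Prop := ∀ c ∈ l, c.x ∈ U ∧ c.y ∈ U

lemma Within.append {m : List (Call A)} (hl : Within U l) (hm : Within U m) :
    Within U (l ++ m) := by
  intro c hc
  rcases List.mem_append.1 hc with hc | hc
  · exact hl c hc
  · exact hm c hc

lemma Within.of_involves (hl : Within U l) (hc : c ∈ l) (he : c.involves e) : e ∈ U := by
  rcases he with rfl | rfl
  · exact (hl c hc).1
  · exact (hl c hc).2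

lemma Within.applySeq_subset (hl : Within U l) (hs : ∀ e ∈ U, s e ⊆ U) :
    ∀ e ∈ U, applySeq l s e ⊆ U := by
  induction l generalizing s with
  | nil => exact hs
  | cons c l ih =>
    refine ih (fun c' hc' => hl c' (List.mem_cons_of_mem _ hc')) fun e he =>
      (?_ : c.apply s e ⊆ U)
    have hc := hl c List.mem_cons_self
    unfold Call.apply
    split_ifs
    · exact Finset.union_subset (hs _ hc.1) (hs _ hc.2)
    · exact hs e he

lemma Within.subset (hl : Within U l) (he : e ∈ U) : applySeq l root e ⊆ U :=
  hl.applySeq_subset (fun _ h => Finset.singleton_subset_iff.2 h) e he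

/-- The calls of `l` between agents of `U`. -/
def restrict (U : Finset A) (l : List (Call A)) : List (Call A) :=
  l.filter fun c => c.x ∈ U ∧ c.y ∈ U

lemma within_restrict (U : Finset A) (l : List (Call A)) : Within U (restrict U l) := by
  intro c hc
  simpa using (List.mem_filter.1 hc).2

lemma restrict_append (U : Finset A) (l m : List (Call A)) :
    restrict U (l ++ m) = restrict U l ++ restrict U m := List.filter_append ..

lemma restrict_singleton (h : ∀ d, c.involves d → d ∈ U) : restrict U [c] = [c] := by
  simp [restrict, h _ c.involves_x, h _ c.involves_y]

lemma mem_of_involves_of_subset (h : applySeq (l ++ [c]) root e ⊆ U) (he : c.involves e) :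
    (∀ d, c.involves d → d ∈ U) ∧ applySeq l root c.x ⊆ U ∧ applySeq l root c.y ⊆ U := by
  rw [applySeq_append, applySeq_cons, applySeq_nil, Call.apply_of_involves he,
    Finset.union_subset_iff] at h
  refine ⟨?_, h⟩
  rintro d (rfl | rfl)
  · exact h.1 (self_mem_applySeq l _)
  · exact h.2 (self_mem_applySeq l _)

lemma applySeq_restrict (h : applySeq l root e ⊆ U) :
    applySeq (restrict U l) root e = applySeq l root e := by
  induction l using List.reverseRecOn generalizing e with
  | nil => rfl
  | append_singleton l c ih =>
    by_cases he : c.involves e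
    · obtain ⟨hc, hx, hy⟩ := mem_of_involves_of_subset h he
      rw [restrict_append, restrict_singleton hc]
      simp [Call.apply_of_involves he, ih hx, ih hy]
    · have hl : applySeq l root e ⊆ U := by
        simpa [Call.apply_of_not_involves he] using h
      rw [restrict_append, applySeq_append, applySeq_append, applySeq_cons, applySeq_nil,
        Call.apply_of_not_involves he, ← ih hl]
      refine applySeq_of_not_involves fun c' hc' => ?_
      rw [List.mem_singleton.1 (List.mem_filter.1 hc').1]
      exact he

end Propagation

/-! ### Individual traces -/

section Trace

variable {a : A} {c : Call A} {l σ τ : List (Call A)} {s : A → Finset A}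

/-- The calls involving `a` in a call sequence performed in the situation `s`, each with the
set of secrets of `a` after that call. -/
def trace (a : A) : (A → Finset A) → List (Call A) → List (Call A × Finset A)
  | _, [] => []
  | s, c :: l =>
    if c.involves a then (c, c.apply s a) :: trace a (c.apply s) l else trace a (c.apply s) l

@[simp] lemma trace_nil : trace a s [] = [] := rfl

lemma trace_cons_of_involves (h : c.involves a) :
    trace a s (c :: l) = (c, c.apply s a) :: trace a (c.apply s) l := if_pos h

lemma trace_cons_of_not_involves (h : ¬ c.involves a) :
    trace a s (c :: l) = trace a (c.apply s) l := if_neg h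

lemma trace_append (l m : List (Call A)) :
    trace a s (l ++ m) = trace a s l ++ trace a (applySeq l s) m := by
  induction l generalizing s with
  | nil => rfl
  | cons c l ih =>
    by_cases h : c.involves a
    · simp [trace_cons_of_involves h, ih]
    · simp [trace_cons_of_not_involves h, ih]

lemma trace_concat_of_involves (h : c.involves a) :
    trace a s (l ++ [c]) = trace a s l ++ [(c, applySeq (l ++ [c]) s a)] := by
  simp [trace_append, trace_cons_of_involves h]

lemma trace_concat_of_not_involves (h : ¬ c.involves a) :
    trace a s (l ++ [c]) = trace a s l := by
  simp [trace_append, trace_cons_of_not_involves h]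

lemma trace_eq_nil (h : ∀ c ∈ l, ¬ c.involves a) : trace a s l = [] := by
  induction l generalizing s with
  | nil => rfl
  | cons c l ih =>
    rw [trace_cons_of_not_involves (h c List.mem_cons_self),
      ih fun c' hc' => h c' (List.mem_cons_of_mem _ hc')]

lemma agEquiv_iff_trace_eq : AgEquiv a σ τ ↔ trace a root σ = trace a root τ := by
  constructor
  · intro h
    induction h with
    | nil => rfl
    | extLeft c hc _ ih => rw [trace_concat_of_not_involves hc, ih]
    | extRight c hc _ ih => rw [trace_concat_of_not_involves hc, ih]
    | call c hc hs _ ih => rw [trace_concat_of_involves hc, trace_concat_of_involves hc, ih, hs]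
  · intro h
    induction σ using List.reverseRecOn generalizing τ with
    | nil =>
      induction τ using List.reverseRecOn with
      | nil => exact .nil
      | append_singleton τ c ih =>
        by_cases hc : c.involves a
        · simp [trace_concat_of_involves hc] at h
        · exact .extRight c hc (ih (by rw [h, trace_concat_of_not_involves hc]))
    | append_singleton σ c ih =>
      by_cases hc : c.involves a
      · induction τ using List.reverseRecOn with
        | nil => simp [trace_concat_of_involves hc] at h
        | append_singleton τ c' ih' =>
          by_cases hc' : c'.involves a
          · rw [trace_concat_of_involves hc, trace_concat_of_involves hc'] at h
            obtain ⟨h₁, h₂⟩ := List.append_inj' h rfl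
            simp only [List.cons.injEq, Prod.mk.injEq, and_true] at h₂
            obtain ⟨rfl, h₂⟩ := h₂
            exact .call c hc h₂ (ih h₁)
          · exact .extRight c' hc' (ih' (by rw [h, trace_concat_of_not_involves hc']))
      · exact .extLeft c hc (ih (by rw [← h, trace_concat_of_not_involves hc]))

lemma AgEquiv.refl (a : A) (σ : List (Call A)) : AgEquiv a σ σ := agEquiv_iff_trace_eq.2 rfl

lemma AgEquiv.symm (h : AgEquiv a σ τ) : AgEquiv a τ σ :=
  agEquiv_iff_trace_eq.2 (agEquiv_iff_trace_eq.1 h).symm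

lemma AgEquiv.trans {υ : List (Call A)} (h : AgEquiv a σ τ) (h' : AgEquiv a τ υ) :
    AgEquiv a σ υ :=
  agEquiv_iff_trace_eq.2 ((agEquiv_iff_trace_eq.1 h).trans (agEquiv_iff_trace_eq.1 h'))

lemma AgEquiv.applySeq_eq (h : AgEquiv a σ τ) : applySeq σ root a = applySeq τ root a := by
  induction h with
  | nil => rfl
  | extLeft c hc _ ih => simpa [Call.apply_of_not_involves hc] using ih
  | extRight c hc _ ih => simpa [Call.apply_of_not_involves hc] using ih
  | call c hc hs _ _ => exact hs

lemma AgEquiv.append_right (h : AgEquiv a σ τ) (hl : ∀ c ∈ l, ¬ c.involves a) :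
    AgEquiv a σ (τ ++ l) := by
  rw [agEquiv_iff_trace_eq] at h ⊢
  rw [h, trace_append, trace_eq_nil hl, List.append_nil]

lemma AgEquiv.of_concat {c' : Call A} (hc : c.involves a) (hc' : c'.involves a)
    (h : AgEquiv a (σ ++ [c]) (τ ++ [c'])) : c = c' ∧ AgEquiv a σ τ := by
  rw [agEquiv_iff_trace_eq, trace_concat_of_involves hc, trace_concat_of_involves hc'] at h
  obtain ⟨h₁, h₂⟩ := List.append_inj' h rfl
  simp only [List.cons.injEq, Prod.mk.injEq, and_true] at h₂
  exact ⟨h₂.1, agEquiv_iff_trace_eq.2 h₁⟩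

lemma AgEquiv.exists_of_concat (hc : c.involves a) (h : AgEquiv a (σ ++ [c]) τ) :
    ∃ τ' l, τ = τ' ++ [c] ++ l ∧ AgEquiv a σ τ' ∧ ∀ c' ∈ l, ¬ c'.involves a := by
  induction τ using List.reverseRecOn with
  | nil =>
    rw [agEquiv_iff_trace_eq] at h
    simp [trace_concat_of_involves hc] at h
  | append_singleton τ c' ih =>
    by_cases hc' : c'.involves a
    · obtain ⟨rfl, h'⟩ := h.of_concat hc hc'
      exact ⟨τ, [], by simp, h', by simp⟩
    · rw [agEquiv_iff_trace_eq, trace_concat_of_not_involves hc', ← agEquiv_iff_trace_eq] at h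
      obtain ⟨τ', l, rfl, h', hl⟩ := ih h
      refine ⟨τ', l ++ [c'], by simp, h', fun c'' hc'' => ?_⟩
      rcases List.mem_append.1 hc'' with hc'' | hc''
      · exact hl _ hc''
      · rwa [List.mem_singleton.1 hc'']

lemma agEquiv_restrict {U : Finset A} (h : applySeq σ root a ⊆ U) :
    AgEquiv a σ (restrict U σ) := by
  induction σ using List.reverseRecOn with
  | nil => exact .nil
  | append_singleton σ c ih =>
    have hσ : applySeq σ root a ⊆ U := by
      refine subset_trans ?_ h
      rw [applySeq_append]
      exact subset_applySeq _ _ _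
    by_cases hc : c.involves a
    · have hr := applySeq_restrict h
      rw [restrict_append, restrict_singleton (mem_of_involves_of_subset h hc).1] at hr ⊢
      exact .call c hc hr.symm (ih hσ)
    · rw [restrict_append]
      refine .extLeft c hc ((ih hσ).append_right fun c' hc' => ?_)
      rwa [List.mem_singleton.1 (List.mem_filter.1 hc').1]

end Trace

/-! ### Pairs of agents -/

section Pair

variable {a b g : A} {c : Call A} {l σ τ υ : List (Call A)} {G : Finset A}

lemma AgEquiv.gEquiv (hg : g ∈ G) (h : AgEquiv g σ τ) : GEquiv G σ τ :=
  Relation.ReflTransGen.single ⟨g, hg, h⟩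

lemma GEquiv.symm (h : GEquiv G σ τ) : GEquiv G τ σ :=
  haveI : Std.Symm fun σ τ : List (Call A) => ∃ a ∈ G, AgEquiv a σ τ :=
    ⟨fun _ _ ⟨a, ha, h⟩ => ⟨a, ha, h.symm⟩⟩
  Relation.ReflTransGen.stdSymm.symm _ _ h

lemma pairView_comm (σ : List (Call A)) (a b : A) : pairView σ a b = pairView σ b a := by
  unfold pairView
  rw [Finset.pair_comm]

lemma GEquiv.pairView_eq (h : GEquiv {a, b} σ τ) : pairView σ a b = pairView τ a b := by
  ext s
  constructor
  · rintro ⟨υ, hυ, rfl⟩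
    exact ⟨υ, h.symm.trans hυ, rfl⟩
  · rintro ⟨υ, hυ, rfl⟩
    exact ⟨υ, h.trans hυ, rfl⟩

lemma gEquiv_append (hab : a ≠ b) (hl : ∀ c ∈ l, ¬ c.isBetween a b) :
    GEquiv {a, b} σ (σ ++ l) := by
  induction l using List.reverseRecOn with
  | nil => rw [List.append_nil]; exact Relation.ReflTransGen.refl
  | append_singleton l c ih =>
    refine (ih fun c' hc' => hl c' (List.mem_append_left _ hc')).trans ?_
    rw [← List.append_assoc]
    have hc := hl c (by simp)
    by_cases ha : c.involves a
    · have hb : ¬ c.involves b := fun hb => hc (Call.isBetween_of_involves hab ha hb)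
      exact (AgEquiv.extRight c hb (.refl _ _)).gEquiv (by simp)
    · exact (AgEquiv.extRight c ha (.refl _ _)).gEquiv (by simp)

lemma gEquiv_singleton_iff : GEquiv {a, a} σ τ ↔ AgEquiv a σ τ := by
  refine ⟨fun h => ?_, fun h => h.gEquiv (by simp)⟩
  induction h with
  | refl => exact .refl _ _
  | tail _ h ih =>
    obtain ⟨g, hg, h⟩ := h
    obtain rfl : g = a := by simpa using hg
    exact ih.trans h

lemma AgEquiv.filter_isBetween_eq (hg : g = a ∨ g = b) (h : AgEquiv g σ τ) :
    (σ.filter fun c => c.isBetween a b) = τ.filter fun c => c.isBetween a b := by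
  have hn : ∀ c : Call A, ¬ c.involves g → ¬ c.isBetween a b := by
    rintro c hc hab
    rcases hg with rfl | rfl
    · exact hc hab.left
    · exact hc hab.right
  induction h with
  | nil => rfl
  | extLeft c hc _ ih => simpa [hn c hc] using ih
  | extRight c hc _ ih => simpa [hn c hc] using ih
  | call c _ _ _ ih => rw [List.filter_append, List.filter_append, ih]

lemma GEquiv.filter_isBetween_eq (h : GEquiv {a, b} σ τ) :
    (σ.filter fun c => c.isBetween a b) = τ.filter fun c => c.isBetween a b := by
  induction h with
  | refl => rfl
  | tail _ h ih =>
    obtain ⟨g, hg, h⟩ := h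
    exact ih.trans (h.filter_isBetween_eq (by simpa using hg))

lemma GEquiv.not_isBetween (h : GEquiv {a, b} σ τ) (hσ : ∀ c ∈ σ, ¬ c.isBetween a b) :
    ∀ c ∈ τ, ¬ c.isBetween a b := by
  have := h.filter_isBetween_eq
  rw [List.filter_eq_nil_iff.2 (by simpa using hσ), eq_comm, List.filter_eq_nil_iff] at this
  simpa using this

/-- The longest prefix of `l` that is empty or ends with a call between `a` and `b`. -/
def core (a b : A) (l : List (Call A)) : List (Call A) :=
  l.rdropWhile fun c => ¬ c.isBetween a b

lemma core_concat_of_isBetween (h : c.isBetween a b) : core a b (l ++ [c]) = l ++ [c] :=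
  List.rdropWhile_concat_neg _ _ _ (by simpa using h)

lemma core_concat_of_not_isBetween (h : ¬ c.isBetween a b) :
    core a b (l ++ [c]) = core a b l :=
  List.rdropWhile_concat_pos _ _ _ (by simpa using h)

lemma exists_eq_core_append (a b : A) (l : List (Call A)) :
    ∃ m, l = core a b l ++ m ∧ ∀ c ∈ m, ¬ c.isBetween a b := by
  induction l using List.reverseRecOn with
  | nil => exact ⟨[], rfl, by simp⟩
  | append_singleton l c ih =>
    by_cases h : c.isBetween a b
    · exact ⟨[], by rw [core_concat_of_isBetween h, List.append_nil], by simp⟩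
    · obtain ⟨m, hm, hm'⟩ := ih
      refine ⟨m ++ [c], ?_, fun c' hc' => ?_⟩
      · rw [core_concat_of_not_isBetween h, ← List.append_assoc, ← hm]
      · rcases List.mem_append.1 hc' with hc' | hc'
        · exact hm' _ hc'
        · rwa [List.mem_singleton.1 hc']

lemma core_eq_nil_or_concat (a b : A) (l : List (Call A)) :
    core a b l = [] ∨ ∃ m c, c.isBetween a b ∧ core a b l = m ++ [c] := by
  induction l using List.reverseRecOn with
  | nil => exact Or.inl rfl
  | append_singleton l c ih =>
    by_cases h : c.isBetween a b
    · exact Or.inr ⟨l, c, h, core_concat_of_isBetween h⟩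
    · rwa [core_concat_of_not_isBetween h]

lemma AgEquiv.core (hg : g = a ∨ g = b) (h : AgEquiv g σ τ) :
    AgEquiv g (core a b σ) (core a b τ) ∧
      applySeq (core a b σ) root a = applySeq (core a b τ) root a ∧
      applySeq (core a b σ) root b = applySeq (core a b τ) root b := by
  have hn : ∀ c : Call A, ¬ c.involves g → ¬ c.isBetween a b := by
    rintro c hc hab
    rcases hg with rfl | rfl
    · exact hc hab.left
    · exact hc hab.right
  induction h with
  | nil => exact ⟨.nil, rfl, rfl⟩
  | extLeft c hc _ ih => rwa [core_concat_of_not_isBetween (hn c hc)]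
  | extRight c hc _ ih => rwa [core_concat_of_not_isBetween (hn c hc)]
  | call c hc hs h ih =>
    by_cases hab : c.isBetween a b
    · simp only [core_concat_of_isBetween hab]
      refine ⟨.call c hc hs h, ?_⟩
      simp only [applySeq_append, applySeq_cons, applySeq_nil, hab.apply, hab.symm.apply] at hs ⊢
      rcases hg with rfl | rfl
      · simp only [hab.apply] at hs
        exact ⟨hs, by rw [Finset.union_comm, hs, Finset.union_comm]⟩
      · simp only [hab.symm.apply] at hs
        exact ⟨by rw [Finset.union_comm, hs, Finset.union_comm], hs⟩
    · rwa [core_concat_of_not_isBetween hab, core_concat_of_not_isBetween hab]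

/-- After a further call `c`, the call sequences are indistinguishable for the pair `a, b`. -/
def Linked (a b : A) (c : Call A) (σ τ : List (Call A)) : Prop :=
  GEquiv {a, b} (σ ++ [c]) (τ ++ [c])

lemma Linked.refl (a b : A) (c : Call A) (σ : List (Call A)) : Linked a b c σ σ :=
  Relation.ReflTransGen.refl

lemma Linked.symm (h : Linked a b c σ τ) : Linked a b c τ σ := GEquiv.symm h

lemma Linked.trans (h : Linked a b c σ τ) (h' : Linked a b c τ υ) : Linked a b c σ υ :=
  Relation.ReflTransGen.trans h h'

lemma Linked.swap (h : Linked a b c σ τ) : Linked b a c σ τ := by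
  unfold Linked
  rw [Finset.pair_comm]
  exact h

lemma AgEquiv.linked (hc : c.isBetween a b) (hg : g = a ∨ g = b) (h : AgEquiv g σ τ)
    (hu : applySeq σ root a ∪ applySeq σ root b = applySeq τ root a ∪ applySeq τ root b) :
    Linked a b c σ τ := by
  refine (AgEquiv.call c ?_ ?_ h).gEquiv (by simpa using hg)
  · rcases hg with rfl | rfl
    · exact hc.left
    · exact hc.right
  · simp only [applySeq_append, applySeq_cons, applySeq_nil]
    rcases hg with rfl | rfl
    · rw [hc.apply, hc.apply, hu]
    · rw [hc.symm.apply, hc.symm.apply, Finset.union_comm, hu, Finset.union_comm]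

lemma exists_last {α : Type*} (p : α → Prop) {l : List α} (h : ∃ x ∈ l, p x) :
    ∃ l₁ x l₂, l = l₁ ++ [x] ++ l₂ ∧ p x ∧ ∀ y ∈ l₂, ¬ p y := by
  induction l using List.reverseRecOn with
  | nil => simp at h
  | append_singleton l x ih =>
    by_cases hx : p x
    · exact ⟨l, x, [], by simp, hx, by simp⟩
    · obtain ⟨l₁, y, l₂, rfl, hy, hl⟩ := ih (by grind)
      exact ⟨l₁, y, l₂ ++ [x], by simp, hy, by grind⟩

lemma exists_first {α : Type*} (p : α → Prop) {l : List α} (h : ∃ x ∈ l, p x) :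
    ∃ l₁ x l₂, l = l₁ ++ [x] ++ l₂ ∧ p x ∧ ∀ y ∈ l₁, ¬ p y := by
  induction l with
  | nil => simp at h
  | cons x l ih =>
    by_cases hx : p x
    · exact ⟨[], x, l, by simp, hx, by simp⟩
    · obtain ⟨l₁, y, l₂, rfl, hy, hl⟩ := ih (by grind)
      exact ⟨x :: l₁, y, l₂, by simp, hy, by grind⟩

lemma GEquiv.exists_core_eq_concat (hc : c.isBetween a b) (h : GEquiv {a, b} (σ ++ [c]) τ) :
    ∃ υ, core a b τ = υ ++ [c] ∧ GEquiv {a, b} σ υ ∧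
      applySeq υ root a ∪ applySeq υ root b = applySeq σ root a ∪ applySeq σ root b := by
  induction h with
  | refl => exact ⟨σ, core_concat_of_isBetween hc, Relation.ReflTransGen.refl, rfl⟩
  | @tail τ τ' _ h ih =>
    obtain ⟨υ, hυ, hσ, hu⟩ := ih
    obtain ⟨g, hg, h⟩ := h
    have hg' : g = a ∨ g = b := by simpa using hg
    obtain ⟨h, hs, -⟩ := h.core hg'
    have hinv : ∀ c' : Call A, c'.isBetween a b → c'.involves g := fun c' hc' => by
      rcases hg' with rfl | rfl
      · exact hc'.left
      · exact hc'.right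
    rw [hυ] at h hs
    rcases core_eq_nil_or_concat a b τ' with h' | ⟨υ', c', hc', h'⟩
    · rw [h', agEquiv_iff_trace_eq, trace_concat_of_involves (hinv c hc)] at h
      simp at h
    · rw [h'] at h hs
      obtain ⟨rfl, hυυ'⟩ := h.of_concat (hinv c hc) (hinv c' hc')
      refine ⟨υ', h', hσ.trans (hυυ'.gEquiv hg), ?_⟩
      simp only [applySeq_append, applySeq_cons, applySeq_nil, hc.apply] at hs
      rw [← hs, hu]

end Pair

/-! ### Gathering secrets at a third agent -/

/-- `a`, `b`, `d` are distinct agents of `U`, and `ν` is a call sequence between agents of `U`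
other than `a` and `b` that makes `d` familiar with all secrets of these agents. -/
structure Frame (U : Finset A) (a b d : A) (ν : List (Call A)) : Prop where
  mem_a : a ∈ U
  mem_b : b ∈ U
  mem_d : d ∈ U
  ne : a ≠ b
  ne_a : a ≠ d
  ne_b : b ≠ d
  within : Within U ν
  not_involves_a : ∀ c ∈ ν, ¬ c.involves a
  not_involves_b : ∀ c ∈ ν, ¬ c.involves b
  gathers : ∀ s : A → Finset A, ∀ e ∈ U, e ≠ a → e ≠ b → s e ⊆ applySeq ν s d

lemma exists_frame {U : Finset A} {a b d : A} (ha : a ∈ U) (hb : b ∈ U) (hd : d ∈ U)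
    (hab : a ≠ b) (had : a ≠ d) (hbd : b ≠ d) : ∃ ν, Frame U a b d ν := by
  have key : ∀ V ⊆ U, ∃ ν : List (Call A), Within U ν ∧ (∀ c ∈ ν, ¬ c.involves a) ∧
      (∀ c ∈ ν, ¬ c.involves b) ∧
      ∀ s : A → Finset A, ∀ e ∈ V, e ≠ a → e ≠ b → s e ⊆ applySeq ν s d := by
    intro V
    induction V using Finset.induction_on with
    | empty => exact fun _ => ⟨[], by simp [Within], by simp, by simp, by simp⟩
    | insert x V _ ih =>
      intro hV
      rw [Finset.insert_subset_iff] at hV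
      obtain ⟨ν, h₁, h₂, h₃, h₄⟩ := ih hV.2
      by_cases hx : x = a ∨ x = b ∨ x = d
      · refine ⟨ν, h₁, h₂, h₃, fun s e he hea heb => ?_⟩
        rcases Finset.mem_insert.1 he with rfl | he
        · obtain rfl : e = d := by tauto
          exact subset_applySeq _ _ _
        · exact h₄ s e he hea heb
      · push Not at hx
        obtain ⟨hxa, hxb, hxd⟩ := hx
        refine ⟨⟨x, d, hxd⟩ :: ν, ?_, ?_, ?_, fun s e he hea heb => ?_⟩
        · exact List.forall_mem_cons.2 ⟨⟨hV.1, hd⟩, h₁⟩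
        · exact List.forall_mem_cons.2 ⟨by rintro (h | h) <;> tauto, h₂⟩
        · exact List.forall_mem_cons.2 ⟨by rintro (h | h) <;> tauto, h₃⟩
        · rcases Finset.mem_insert.1 he with rfl | he
          · exact subset_applySeq_of_mem List.mem_cons_self (Or.inl rfl) (Or.inr rfl)
          · exact (Call.subset_apply _ _ _).trans (h₄ _ e he hea heb)
  obtain ⟨ν, h₁, h₂, h₃, h₄⟩ := key U subset_rfl
  exact ⟨ν, ha, hb, hd, hab, had, hbd, h₁, h₂, h₃, h₄⟩

namespace Frame

variable {U : Finset A} {a b d : A} {ν : List (Call A)} {c : Call A} {σ τ l : List (Call A)}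

lemma symm (F : Frame U a b d ν) : Frame U b a d ν where
  mem_a := F.mem_b
  mem_b := F.mem_a
  mem_d := F.mem_d
  ne := F.ne.symm
  ne_a := F.ne_b
  ne_b := F.ne_a
  within := F.within
  not_involves_a := F.not_involves_b
  not_involves_b := F.not_involves_a
  gathers s e he hb ha := F.gathers s e he ha hb

/-- `d` gathers all secrets of agents other than `a` and `b`, then calls `b`, then `a`. -/
def close (F : Frame U a b d ν) (σ : List (Call A)) : List (Call A) :=
  σ ++ ν ++ [⟨b, d, F.ne_b⟩, ⟨a, d, F.ne_a⟩]

lemma within_close (F : Frame U a b d ν) (hσ : Within U σ) : Within U (F.close σ) := by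
  refine (hσ.append F.within).append ?_
  simp [Within, F.mem_a, F.mem_b, F.mem_d]

lemma linked_left (F : Frame U a b d ν) (hc : c.isBetween a b) (hσ : Within U σ)
    (hτ : Within U τ) (h : AgEquiv a σ τ) (hf : applySeq σ root a = U) : Linked a b c σ τ := by
  refine h.linked hc (Or.inl rfl) ?_
  rw [← h.applySeq_eq, hf, Finset.union_eq_left.2 (hσ.subset F.mem_b),
    Finset.union_eq_left.2 (hτ.subset F.mem_b)]

lemma linked_right (F : Frame U a b d ν) (hc : c.isBetween a b) (hσ : Within U σ)
    (hτ : Within U τ) (h : AgEquiv b σ τ) (hf : applySeq σ root b = U) : Linked a b c σ τ :=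
  (F.symm.linked_left hc.symm hσ hτ h hf).swap

lemma gather_union (F : Frame U a b d ν) (hσ : Within U σ)
    (h : ∃ e ∈ U, e ≠ a ∧ a ∈ applySeq σ root e) :
    applySeq (σ ++ ν) root b ∪ applySeq (σ ++ ν) root d = U := by
  have key : ∀ e ∈ U, e ≠ a → applySeq σ root e ⊆
      applySeq (σ ++ ν) root b ∪ applySeq (σ ++ ν) root d := by
    intro e he hea
    rw [applySeq_append]
    by_cases heb : e = b
    · subst heb
      exact (subset_applySeq _ _ _).trans Finset.subset_union_left
    · exact (F.gathers _ e he hea heb).trans Finset.subset_union_right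
  have hσν := hσ.append F.within
  refine subset_antisymm
    (Finset.union_subset (hσν.subset F.mem_b) (hσν.subset F.mem_d)) fun x hx => ?_
  by_cases hxa : x = a
  · subst hxa
    obtain ⟨e, he, hea, hxe⟩ := h
    exact key e he hea hxe
  · exact key x hx hxa (self_mem_applySeq σ x)

lemma applySeq_pair (F : Frame U a b d ν) (s : A → Finset A) :
    applySeq [⟨b, d, F.ne_b⟩, ⟨a, d, F.ne_a⟩] s a = s a ∪ (s b ∪ s d) := by
  have := F.ne
  have := F.ne_a
  have := F.ne_b
  simp [Call.apply, *]

lemma trace_pair (F : Frame U a b d ν) (s : A → Finset A) :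
    trace a s [⟨b, d, F.ne_b⟩, ⟨a, d, F.ne_a⟩] = [(⟨a, d, F.ne_a⟩, s a ∪ (s b ∪ s d))] := by
  have := F.ne
  have := F.ne_a
  have := F.ne_b
  simp [trace, Call.apply, Call.involves, *]

lemma trace_pair_symm (F : Frame U a b d ν) (s : A → Finset A) :
    trace b s [⟨b, d, F.ne_b⟩, ⟨a, d, F.ne_a⟩] = [(⟨b, d, F.ne_b⟩, s b ∪ s d)] := by
  have := F.ne.symm
  have := F.ne_a
  have := F.ne_b
  simp [trace, Call.apply, Call.involves, *]

lemma gather_union_union (F : Frame U a b d ν) (hσ : Within U σ) :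
    applySeq (σ ++ ν) root a ∪ (applySeq (σ ++ ν) root b ∪ applySeq (σ ++ ν) root d) = U := by
  have hσν := hσ.append F.within
  refine subset_antisymm (Finset.union_subset (hσν.subset F.mem_a)
    (Finset.union_subset (hσν.subset F.mem_b) (hσν.subset F.mem_d))) fun x hx => ?_
  by_cases hxa : x = a
  · subst hxa
    exact Finset.mem_union_left _ (self_mem_applySeq _ _)
  by_cases hxb : x = b
  · subst hxb
    exact Finset.mem_union_right _ (Finset.mem_union_left _ (self_mem_applySeq _ _))
  · rw [applySeq_append]
    exact Finset.mem_union_right _ (Finset.mem_union_right _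
      (F.gathers _ x hx hxa hxb (self_mem_applySeq σ x)))

lemma trace_close (F : Frame U a b d ν) (hσ : Within U σ) :
    trace a root (F.close σ) = trace a root σ ++ [(⟨a, d, F.ne_a⟩, U)] := by
  rw [close, trace_append, trace_append, trace_eq_nil F.not_involves_a, F.trace_pair,
    F.gather_union_union hσ, List.append_nil]

lemma trace_close_right (F : Frame U a b d ν) (σ : List (Call A)) :
    trace b root (F.close σ) = trace b root σ ++
      [(⟨b, d, F.ne_b⟩, applySeq (σ ++ ν) root b ∪ applySeq (σ ++ ν) root d)] := by
  rw [close, trace_append, trace_append, trace_eq_nil F.not_involves_b, F.trace_pair_symm,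
    List.append_nil]

lemma applySeq_close (F : Frame U a b d ν) (hσ : Within U σ) :
    applySeq (F.close σ) root a = U := by
  rw [close, applySeq_append, F.applySeq_pair, F.gather_union_union hσ]

lemma linked_close_close (F : Frame U a b d ν) (hc : c.isBetween a b) (hσ : Within U σ)
    (hτ : Within U τ) (h : AgEquiv a σ τ) : Linked a b c (F.close σ) (F.close τ) := by
  refine F.linked_left hc (F.within_close hσ) (F.within_close hτ) ?_ (F.applySeq_close hσ)
  rw [agEquiv_iff_trace_eq] at h ⊢
  rw [F.trace_close hσ, F.trace_close hτ, h]

/-- After `σ`, some agent of `U` is familiar with a secret of `a` or `b` other than their own. -/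
def Mingled (U : Finset A) (a b : A) (σ : List (Call A)) : Prop :=
  (∃ e ∈ U, e ≠ a ∧ a ∈ applySeq σ root e) ∨ ∃ e ∈ U, e ≠ b ∧ b ∈ applySeq σ root e

lemma Mingled.symm (h : Mingled U a b σ) : Mingled U b a σ := Or.symm h

lemma Mingled.append (h : Mingled U a b σ) (l : List (Call A)) : Mingled U a b (σ ++ l) := by
  unfold Mingled
  rw [applySeq_append]
  exact h.imp (fun ⟨e, he, hne, hm⟩ => ⟨e, he, hne, subset_applySeq _ _ _ hm⟩)
    fun ⟨e, he, hne, hm⟩ => ⟨e, he, hne, subset_applySeq _ _ _ hm⟩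

lemma mingled_of_involves_left {c' : Call A} (hσ : Within U σ) (hc : c' ∈ σ)
    (h : c'.involves a) : Mingled U a b σ := by
  rcases h with rfl | rfl
  · exact Or.inl ⟨c'.y, (hσ c' hc).2, c'.ne.symm,
      subset_applySeq_of_mem hc c'.involves_x c'.involves_y (Finset.mem_singleton_self _)⟩
  · exact Or.inl ⟨c'.x, (hσ c' hc).1, c'.ne,
      subset_applySeq_of_mem hc c'.involves_y c'.involves_x (Finset.mem_singleton_self _)⟩

lemma linked_close_close_symm (F : Frame U a b d ν) (hc : c.isBetween a b) (hσ : Within U σ)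
    (h : Mingled U a b σ) : Linked a b c (F.close σ) (F.symm.close σ) := by
  have key : ∀ {a b : A} (F : Frame U a b d ν), c.isBetween a b →
      (∃ e ∈ U, e ≠ a ∧ a ∈ applySeq σ root e) →
      Linked a b c (F.symm.close σ) (F.close σ) := by
    intro a b F hc h
    refine F.linked_right hc (F.symm.within_close hσ) (F.within_close hσ) ?_
      (F.symm.applySeq_close hσ)
    rw [agEquiv_iff_trace_eq, F.symm.trace_close hσ, F.trace_close_right, F.gather_union hσ h]
  rcases h with h | h
  · exact (key F hc h).symm
  · exact (key F.symm hc.symm h).swap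

lemma linked_close_append (F : Frame U a b d ν) (hc : c.isBetween a b)
    (hσ : Within U (σ ++ l)) (h : Mingled U a b σ) (hl : ∀ c ∈ l, ¬ c.isBetween a b) :
    Linked a b c (F.close (σ ++ l)) (F.close σ) := by
  induction l using List.reverseRecOn with
  | nil => rw [List.append_nil]; exact .refl _ _ _ _
  | append_singleton l c' ih =>
    rw [← List.append_assoc] at hσ ⊢
    have hσ' : Within U (σ ++ l) := fun c hc => hσ c (List.mem_append_left _ hc)
    refine Linked.trans ?_ (ih hσ' fun c hc => hl c (List.mem_append_left _ hc))
    by_cases ha : c'.involves a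
    · have hb : ¬ c'.involves b := fun hb =>
        hl c' (by simp) (Call.isBetween_of_involves F.ne ha hb)
      refine (F.linked_close_close_symm hc hσ ((h.append l).append _)).trans ?_
      refine Linked.trans ?_ (F.linked_close_close_symm hc hσ' (h.append l)).symm
      exact (F.symm.linked_close_close hc.symm hσ hσ' (.extLeft c' hb (.refl _ _))).swap
    · exact F.linked_close_close hc hσ hσ' (.extLeft c' ha (.refl _ _))

/-- A call sequence in which `a` makes a call can be completed, unnoticed by `a`, so that `b`
learns all secrets of `U`. -/
lemma exists_agEquiv_full (F : Frame U a b d ν) (hσ : Within U σ)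
    (hu : applySeq σ root a ∪ applySeq σ root b = U) (h : ∃ c ∈ σ, c.involves a) :
    ∃ τ, Within U τ ∧ AgEquiv a σ τ ∧ applySeq τ root b = U ∧
      ∃ e ∈ U, e ≠ b ∧ b ∈ applySeq τ root e := by
  obtain ⟨σ₁, c₁, σ₂, rfl, hc₁, hσ₂⟩ := exists_last (fun c : Call A => c.involves a) h
  have hlast : applySeq (σ₁ ++ [c₁] ++ σ₂) root a = applySeq (σ₁ ++ [c₁]) root a := by
    rw [applySeq_append, applySeq_of_not_involves hσ₂]
  by_cases hb : c₁.involves b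
  · have hbt := Call.isBetween_of_involves F.ne hc₁ hb
    refine ⟨_, hσ, .refl _ _, ?_, a, F.mem_a, F.ne, ?_⟩
    · have : applySeq (σ₁ ++ [c₁] ++ σ₂) root a ⊆ applySeq (σ₁ ++ [c₁] ++ σ₂) root b := by
        rw [hlast, applySeq_append (σ₁ ++ [c₁])]
        refine subset_trans ?_ (subset_applySeq _ _ _)
        simp [hbt.apply, hbt.symm.apply, Finset.union_comm]
      rwa [Finset.union_eq_right.2 this] at hu
    · exact subset_applySeq_of_mem (s := root) (c := c₁) (d := b) (by simp) hb hc₁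
        (Finset.mem_singleton_self _)
  · obtain ⟨e, hea, heb, hce⟩ : ∃ e, e ≠ a ∧ b ≠ e ∧ c₁.involves e := by
      have hne := c₁.ne
      unfold Call.involves at hc₁ hb
      rcases hc₁ with rfl | rfl
      · exact ⟨c₁.y, hne.symm, by tauto, c₁.involves_y⟩
      · exact ⟨c₁.x, hne, by tauto, c₁.involves_x⟩
    have heU : e ∈ U := hσ.of_involves (by simp) hce
    have hτ : Within U (σ₁ ++ [c₁] ++ [⟨b, e, heb⟩] ++ σ₂) := by
      intro c' hc'
      simp only [List.mem_append, List.mem_singleton] at hc'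
      rcases hc' with (hc' | rfl) | hc'
      · exact hσ c' (by simp only [List.mem_append, List.mem_singleton]; exact Or.inl hc')
      · exact ⟨F.mem_b, heU⟩
      · exact hσ c' (by simp [hc'])
    refine ⟨_, hτ, ?_, subset_antisymm (hτ.subset F.mem_b) ?_, e, heU, heb.symm, ?_⟩
    · rw [agEquiv_iff_trace_eq, trace_append (σ₁ ++ [c₁]) σ₂, trace_append (_ ++ [_]) σ₂,
        trace_eq_nil hσ₂, trace_eq_nil hσ₂,
        trace_concat_of_not_involves (l := σ₁ ++ [c₁])]
      rintro (h | h)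
      · exact F.ne h
      · exact hea h.symm
    · rw [← hu]
      refine Finset.union_subset ?_ ?_
      · rw [hlast, applySeq_append (_ ++ _ ++ _)]
        refine subset_trans ?_ (subset_applySeq _ _ _)
        rw [applySeq_append (σ₁ ++ [c₁]) [_]]
        refine subset_trans ?_ (subset_applySeq_of_mem (d := e) (List.mem_singleton_self _)
          (Or.inr rfl) (Or.inl rfl))
        simp [Call.apply_of_involves hc₁, Call.apply_of_involves hce]
      · rw [applySeq_append _ σ₂, applySeq_append _ σ₂, applySeq_append (σ₁ ++ [c₁]) [_]]
        exact applySeq_mono _ (subset_applySeq _ _) _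
    · exact subset_applySeq_of_mem (s := root) (d := b) (c := ⟨b, e, heb⟩) (by simp)
        (Or.inl rfl) (Or.inr rfl) (Finset.mem_singleton_self _)

lemma linked_close (F : Frame U a b d ν) (hc : c.isBetween a b) (hσ : Within U σ)
    (hu : applySeq σ root a ∪ applySeq σ root b = U) (h : ∃ c ∈ σ, c.involves a) :
    Linked a b c σ (F.close σ) := by
  obtain ⟨τ, hτ, hστ, hf, hb⟩ := F.exists_agEquiv_full hσ hu h
  have h₁ : Linked a b c σ τ := by
    refine hστ.linked hc (Or.inl rfl) ?_
    rw [hu, hf, Finset.union_eq_right.2 (hτ.subset F.mem_a)]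
  have hext : Within U (τ ++ ν ++ [⟨a, d, F.ne_a⟩]) :=
    (hτ.append F.within).append (by simp [Within, F.mem_a, F.mem_d])
  have h₂ : Linked a b c τ (τ ++ ν ++ [⟨a, d, F.ne_a⟩]) := by
    refine F.linked_right hc hτ hext ?_ hf
    refine ((AgEquiv.refl b τ).append_right F.not_involves_b).append_right ?_
    simp only [List.mem_singleton, forall_eq]
    rintro (h | h)
    · exact F.ne h.symm
    · exact F.ne_b h
  have hinv : (⟨a, d, F.ne_a⟩ : Call A).involves a := Or.inl rfl
  have hstate : applySeq (τ ++ ν ++ [⟨a, d, F.ne_a⟩]) root a = U := by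
    rw [applySeq_append _ [_], applySeq_cons, applySeq_nil, Call.apply_of_involves hinv]
    exact F.symm.gather_union hτ hb
  refine h₁.trans (h₂.trans (F.linked_left hc hext (F.within_close hσ) ?_ hstate))
  rw [agEquiv_iff_trace_eq, F.trace_close hσ, trace_concat_of_involves hinv, hstate,
    trace_append, trace_eq_nil F.not_involves_a, List.append_nil,
    agEquiv_iff_trace_eq.1 hστ]

/-- If the first call involving `a` or `b` is one of `b`, then `σ` is linked to a fixed
call sequence. -/
lemma linked_close_nil (F : Frame U a b d ν) (hc : c.isBetween a b) {ρ : List (Call A)}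
    {c₁ : Call A} (hσ : Within U (ρ ++ [c₁] ++ l))
    (hu : applySeq (ρ ++ [c₁] ++ l) root a ∪ applySeq (ρ ++ [c₁] ++ l) root b = U)
    (hn : ∀ c ∈ ρ ++ [c₁] ++ l, ¬ c.isBetween a b) (hρ : ∀ c ∈ ρ, ¬ c.involves a)
    (hc₁ : c₁.involves b) : Linked a b c (ρ ++ [c₁] ++ l) (F.close []) := by
  have hρc : Within U (ρ ++ [c₁]) := fun c hc => hσ c (List.mem_append_left _ hc)
  have hm : Mingled U a b (ρ ++ [c₁]) := (mingled_of_involves_left hρc (by simp) hc₁).symm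
  have h₁ : Linked a b c (ρ ++ [c₁] ++ l) (F.symm.close (ρ ++ [c₁] ++ l)) :=
    (F.symm.linked_close hc.symm hσ (by rwa [Finset.union_comm]) ⟨c₁, by simp, hc₁⟩).swap
  refine h₁.trans ((F.linked_close_close_symm hc hσ (hm.append l)).symm.trans
    ((F.linked_close_append hc hσ hm fun c hc => hn c (List.mem_append_right _ hc)).trans
      (F.linked_close_close hc hρc (by simp [Within]) ?_)))
  refine .extLeft c₁ (fun ha => hn c₁ (by simp) (Call.isBetween_of_involves F.ne ha hc₁)) ?_
  exact ((AgEquiv.refl a []).append_right hρ).symm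

lemma linked_close_nil_symm (F : Frame U a b d ν) (hc : c.isBetween a b) {e : A} (he : e ∈ U)
    (hea : a ≠ e) (heb : b ≠ e) (hed : e ≠ d) :
    Linked a b c (F.close []) (F.symm.close []) := by
  have hnil : Within U [] := by simp [Within]
  have hb : Within U [⟨b, d, F.ne_b⟩] := by simp [Within, F.mem_b, F.mem_d]
  have ha : Within U [⟨a, e, hea⟩] := by simp [Within, F.mem_a, he]
  have hma : Mingled U a b [⟨a, e, hea⟩] :=
    mingled_of_involves_left ha List.mem_cons_self (Or.inl rfl)
  have hmb : Mingled U a b [⟨b, d, F.ne_b⟩] :=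
    (mingled_of_involves_left hb List.mem_cons_self (Or.inl rfl)).symm
  have hnb : ¬ (⟨b, d, F.ne_b⟩ : Call A).involves a := by
    rintro (h | h)
    · exact F.ne h
    · exact F.ne_a h
  have hna : ¬ (⟨a, e, hea⟩ : Call A).involves b := by
    rintro (h | h)
    · exact F.ne h.symm
    · exact heb h
  have h₁ : Linked a b c (F.close []) (F.close [⟨b, d, F.ne_b⟩]) :=
    F.linked_close_close hc hnil hb (.extRight (σ := []) (τ := []) _ hnb .nil)
  have h₂ := F.linked_close_close_symm hc hb hmb
  have h₃ : Linked a b c (F.symm.close [⟨b, d, F.ne_b⟩])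
      (F.symm.close ([⟨a, e, hea⟩] ++ [⟨b, d, F.ne_b⟩])) := by
    refine (F.symm.linked_close_close hc.symm hb (ha.append hb) ?_).swap
    rw [agEquiv_iff_trace_eq]
    have := F.ne
    have := F.ne_a
    have := F.ne_b
    simp [trace, Call.involves, Call.apply, *, F.ne.symm, hed.symm, F.ne_a.symm]
  have h₄ := (F.linked_close_close_symm hc (ha.append hb) (hma.append _)).symm
  have h₅ : Linked a b c (F.close ([⟨a, e, hea⟩] ++ [⟨b, d, F.ne_b⟩]))
      (F.close [⟨a, e, hea⟩]) :=
    F.linked_close_close hc (ha.append hb) ha (.extLeft _ hnb (.refl _ _))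
  have h₆ := F.linked_close_close_symm hc ha hma
  have h₇ : Linked a b c (F.symm.close [⟨a, e, hea⟩]) (F.symm.close []) :=
    (F.symm.linked_close_close hc.symm ha hnil (.extLeft (σ := []) _ hna .nil)).swap
  exact h₁.trans (h₂.trans (h₃.trans (h₄.trans (h₅.trans (h₆.trans h₇)))))

end Frame

/-! ### Call sequences with the same joint secrets -/

section Joint

variable {U : Finset A} {a b d : A} {ν : List (Call A)} {c : Call A} {σ τ l : List (Call A)}

lemma not_isBetween_restrict (h : ∀ c ∈ σ, ¬ c.isBetween a b) :
    ∀ c ∈ restrict U σ, ¬ c.isBetween a b :=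
  fun c hc => h c (List.mem_filter.1 hc).1

lemma restrict_of_joint (hu : applySeq σ root a ∪ applySeq σ root b = U) :
    applySeq (restrict U σ) root a = applySeq σ root a ∧
      applySeq (restrict U σ) root b = applySeq σ root b := by
  rw [← hu]
  exact ⟨applySeq_restrict Finset.subset_union_left, applySeq_restrict Finset.subset_union_right⟩

lemma joint_restrict (hu : applySeq σ root a ∪ applySeq σ root b = U) :
    applySeq (restrict U σ) root a ∪ applySeq (restrict U σ) root b = U := by
  rw [(restrict_of_joint hu).1, (restrict_of_joint hu).2, hu]

lemma linked_restrict (hc : c.isBetween a b)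
    (hu : applySeq σ root a ∪ applySeq σ root b = U) : Linked a b c σ (restrict U σ) := by
  refine AgEquiv.linked hc (Or.inl rfl) (agEquiv_restrict ?_) (hu.trans (joint_restrict hu).symm)
  rw [← hu]
  exact Finset.subset_union_left

lemma mem_joint_left (hu : applySeq σ root a ∪ applySeq σ root b = U) : a ∈ U := by
  rw [← hu]
  exact Finset.mem_union_left _ (self_mem_applySeq _ _)

lemma mem_joint_right (hu : applySeq σ root a ∪ applySeq σ root b = U) : b ∈ U := by
  rw [← hu]
  exact Finset.mem_union_right _ (self_mem_applySeq _ _)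

lemma linked_of_joint_eq_pair (hc : c.isBetween a b) (h : ∀ d ∈ U, d = a ∨ d = b)
    (hσ : applySeq σ root a ∪ applySeq σ root b = U)
    (hτ : applySeq τ root a ∪ applySeq τ root b = U)
    (hf : (σ.filter fun c => c.isBetween a b) = τ.filter fun c => c.isBetween a b) :
    Linked a b c σ τ := by
  have ha := mem_joint_left hσ
  have hb := mem_joint_right hσ
  have key : ∀ l : List (Call A), restrict U l = l.filter fun c => c.isBetween a b := by
    refine fun l => List.filter_congr fun c' _ => ?_
    have hne := c'.ne
    have hx := h c'.x
    have hy := h c'.y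
    rw [decide_eq_decide]
    unfold Call.isBetween
    grind
  refine (linked_restrict hc hσ).trans (Linked.trans ?_ (linked_restrict hc hτ).symm)
  rw [key, key, hf]
  exact .refl _ _ _ _

lemma mingled_restrict_core (ha : a ∈ U) (hb : b ∈ U) (h : ∃ c ∈ σ, c.isBetween a b) :
    Frame.Mingled U a b (restrict U (core a b σ)) := by
  obtain ⟨c, hc, hab⟩ := h
  obtain ⟨m, hm, hm'⟩ := exists_eq_core_append a b σ
  rw [hm] at hc
  have hcm : c ∈ core a b σ := (List.mem_append.1 hc).resolve_right fun hc => hm' c hc hab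
  refine Frame.mingled_of_involves_left (c' := c) (within_restrict _ _) ?_ hab.left
  refine List.mem_filter.2 ⟨hcm, ?_⟩
  rcases hab with ⟨rfl, rfl⟩ | ⟨rfl, rfl⟩ <;> simp [ha, hb]

lemma applySeq_core_subset (σ : List (Call A)) (e : A) :
    applySeq (core a b σ) root e ⊆ applySeq σ root e := by
  obtain ⟨m, hm, -⟩ := exists_eq_core_append a b σ
  conv_rhs => rw [hm, applySeq_append]
  exact subset_applySeq _ _ _

lemma GEquiv.exists_isBetween (h : GEquiv {a, b} σ τ) (hσ : ∃ c ∈ σ, c.isBetween a b) :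
    ∃ c ∈ τ, c.isBetween a b := by
  by_contra! hτ
  obtain ⟨c, hc, hab⟩ := hσ
  exact h.symm.not_isBetween hτ c hc hab

lemma GEquiv.linked_close_core (F : Frame U a b d ν) (hc : c.isBetween a b)
    (h : GEquiv {a, b} σ τ) (hk : ∃ c ∈ σ, c.isBetween a b)
    (ha : applySeq (core a b σ) root a ⊆ U) (hb : applySeq (core a b σ) root b ⊆ U) :
    Linked a b c (F.close (restrict U (core a b σ))) (F.close (restrict U (core a b τ))) := by
  suffices applySeq (core a b τ) root a ⊆ U ∧ applySeq (core a b τ) root b ⊆ U ∧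
      Linked a b c (F.close (restrict U (core a b σ))) (F.close (restrict U (core a b τ))) from
    this.2.2
  induction h with
  | refl => exact ⟨ha, hb, .refl _ _ _ _⟩
  | @tail τ τ' hτ h ih =>
    obtain ⟨ha, hb, hl⟩ := ih
    have hτ' := hτ.tail h
    obtain ⟨g, hg, h⟩ := h
    have hg : g = a ∨ g = b := by simpa using hg
    obtain ⟨h, hsa, hsb⟩ := h.core hg
    have ha' := ha
    have hb' := hb
    rw [hsa] at ha'
    rw [hsb] at hb'
    refine ⟨ha', hb', hl.trans ?_⟩
    have hw := within_restrict U (core a b τ)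
    have hw' := within_restrict U (core a b τ')
    rcases hg with rfl | rfl
    · exact F.linked_close_close hc hw hw'
        (((agEquiv_restrict ha).symm.trans h).trans (agEquiv_restrict ha'))
    · refine (F.linked_close_close_symm hc hw (mingled_restrict_core F.mem_a F.mem_b
        (GEquiv.exists_isBetween hτ hk))).trans (Linked.trans ?_
        (F.linked_close_close_symm hc hw' (mingled_restrict_core F.mem_a F.mem_b
        (GEquiv.exists_isBetween hτ' hk))).symm)
      exact (F.symm.linked_close_close hc.symm hw hw'
        (((agEquiv_restrict hb).symm.trans h).trans (agEquiv_restrict hb'))).swap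

lemma linked_close_restrict_core (F : Frame U a b d ν) (hc : c.isBetween a b)
    (hk : ∃ c ∈ σ, c.isBetween a b) (hu : applySeq σ root a ∪ applySeq σ root b = U) :
    Linked a b c σ (F.close (restrict U (core a b σ))) := by
  have hm := mingled_restrict_core F.mem_a F.mem_b hk
  obtain ⟨c', hc', hab⟩ := hk
  have hmem : c' ∈ restrict U σ := by
    refine List.mem_filter.2 ⟨hc', ?_⟩
    rcases hab with ⟨rfl, rfl⟩ | ⟨rfl, rfl⟩ <;> simp [F.mem_a, F.mem_b]
  obtain ⟨m, hσ, hnb⟩ := exists_eq_core_append a b σ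
  refine (linked_restrict hc hu).trans ((F.linked_close hc (within_restrict U σ)
    (joint_restrict hu) ⟨c', hmem, hab.left⟩).trans ?_)
  have hr : restrict U σ = restrict U (core a b σ) ++ restrict U m := by
    rw [← restrict_append, ← hσ]
  rw [hr]
  exact F.linked_close_append hc (hr ▸ within_restrict U σ) hm (not_isBetween_restrict hnb)

lemma GEquiv.linked (hab : a ≠ b) (hc : c.isBetween a b) (h : GEquiv {a, b} σ τ)
    (hk : ∃ c ∈ σ, c.isBetween a b)
    (hu : applySeq σ root a ∪ applySeq σ root b = applySeq τ root a ∪ applySeq τ root b) :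
    Linked a b c σ τ := by
  obtain ⟨U, hU⟩ : ∃ U, applySeq σ root a ∪ applySeq σ root b = U := ⟨_, rfl⟩
  have hU' := hu.symm.trans hU
  by_cases hd : ∃ d ∈ U, d ≠ a ∧ d ≠ b
  · obtain ⟨d, hd, hda, hdb⟩ := hd
    obtain ⟨ν, F⟩ := exists_frame (mem_joint_left hU) (mem_joint_right hU) hd hab hda.symm
      hdb.symm
    refine (linked_close_restrict_core F hc hk hU).trans (Linked.trans (h.linked_close_core F hc hk ?_ ?_)
      (linked_close_restrict_core F hc (h.exists_isBetween hk) hU').symm)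
    · exact (applySeq_core_subset σ a).trans (hU ▸ Finset.subset_union_left)
    · exact (applySeq_core_subset σ b).trans (hU ▸ Finset.subset_union_right)
  · refine linked_of_joint_eq_pair hc (fun d hdU => ?_) hU hU' h.filter_isBetween_eq
    by_contra! hne
    exact hd ⟨d, hdU, hne⟩

/-- Among the calls of `σ` between agents of `U`, the first one involving `a` or `b`
involves `b`. -/
def FirstBy (U : Finset A) (a b : A) (σ : List (Call A)) : Prop :=
  ∃ ρ c l, restrict U σ = ρ ++ [c] ++ l ∧ (∀ c ∈ ρ, ¬ c.involves a) ∧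
    (∀ c ∈ ρ, ¬ c.involves b) ∧ c.involves b

lemma firstBy_or_firstBy (F : Frame U a b d ν)
    (hu : applySeq σ root a ∪ applySeq σ root b = U) : FirstBy U a b σ ∨ FirstBy U b a σ := by
  have hex : ∃ c ∈ restrict U σ, c.involves a ∨ c.involves b := by
    by_contra! h
    have hd := F.mem_d
    rw [← joint_restrict hu, applySeq_of_not_involves fun c hc => (h c hc).1,
      applySeq_of_not_involves fun c hc => (h c hc).2] at hd
    have := F.ne_a.symm
    have := F.ne_b.symm
    simp_all [root]
  obtain ⟨ρ, c, l, h, hc, hρ⟩ :=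
    exists_first (fun c : Call A => c.involves a ∨ c.involves b) hex
  push Not at hρ
  rcases hc with hc | hc
  · exact Or.inr ⟨ρ, c, l, h, fun c hc => (hρ c hc).2, fun c hc => (hρ c hc).1, hc⟩
  · exact Or.inl ⟨ρ, c, l, h, fun c hc => (hρ c hc).1, fun c hc => (hρ c hc).2, hc⟩

lemma FirstBy.linked (F : Frame U a b d ν) (hc : c.isBetween a b) (h : FirstBy U a b σ)
    (hu : applySeq σ root a ∪ applySeq σ root b = U) (hn : ∀ c ∈ σ, ¬ c.isBetween a b) :
    Linked a b c σ (F.close []) := by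
  refine (linked_restrict hc hu).trans ?_
  obtain ⟨ρ, c₁, l, h, hρa, -, hc₁⟩ := h
  have hw := within_restrict U σ
  have hu' := joint_restrict hu
  have hn' := not_isBetween_restrict (U := U) hn
  rw [h] at hw hu' hn' ⊢
  exact F.linked_close_nil hc hw hu' hn' hρa hc₁

lemma involves_of_mem_three (h3 : ∀ e ∈ U, e = a ∨ e = b ∨ e = d) (hx : c.x ∈ U ∧ c.y ∈ U)
    (hn : ¬ c.isBetween a b) (h : c.involves a) : c.isBetween a d := by
  have hne := c.ne
  have hx' := h3 _ hx.1
  have hy' := h3 _ hx.2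
  unfold Call.involves at h
  unfold Call.isBetween at hn ⊢
  grind

lemma trace_filter_not_involves (F : Frame U a b d ν)
    (h3 : ∀ e ∈ U, e = a ∨ e = b ∨ e = d) (hl : Within U l)
    (hn : ∀ c ∈ l, ¬ c.isBetween a b) {s t : A → Finset A}
    (hs : ∀ e ∈ U, s e ⊆ U) (ht : ∀ e ∈ U, t e ⊆ U) (hsa : a ∈ s a) (hta : a ∈ t a)
    (hsb : b ∈ s d) (htb : b ∈ t d) (hsd : d ∈ s d) (htd : d ∈ t d) :
    trace a s l = trace a t (l.filter fun c => ¬ c.involves b) := by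
  have hfull : ∀ {s : A → Finset A}, (∀ e ∈ U, s e ⊆ U) → a ∈ s a → b ∈ s d → d ∈ s d →
      s a ∪ s d = U := by
    intro s hs hsa hsb hsd
    refine subset_antisymm (Finset.union_subset (hs a F.mem_a) (hs d F.mem_d)) fun e he => ?_
    rcases h3 e he with rfl | rfl | rfl
    · exact Finset.mem_union_left _ hsa
    · exact Finset.mem_union_right _ hsb
    · exact Finset.mem_union_right _ hsd
  induction l generalizing s t with
  | nil => rfl
  | cons c l ih =>
    rw [Within, List.forall_mem_cons] at hl
    rw [List.forall_mem_cons] at hn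
    have hw : Within U [c] := by simpa [Within] using hl.1
    have hs' : ∀ e ∈ U, c.apply s e ⊆ U := hw.applySeq_subset hs
    have ht' : ∀ e ∈ U, c.apply t e ⊆ U := hw.applySeq_subset ht
    by_cases hb : c.involves b
    · have ha : ¬ c.involves a := fun ha => hn.1 (Call.isBetween_of_involves F.ne ha hb)
      rw [trace_cons_of_not_involves ha, List.filter_cons_of_neg (by simpa using hb)]
      exact ih hl.2 hn.2 hs' ht (c.subset_apply s a hsa) hta (c.subset_apply s d hsb) htb
        (c.subset_apply s d hsd) htd
    · rw [List.filter_cons_of_pos (by simpa using hb)]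
      have := ih hl.2 hn.2 hs' ht' (c.subset_apply s a hsa) (c.subset_apply t a hta)
        (c.subset_apply s d hsb) (c.subset_apply t d htb) (c.subset_apply s d hsd)
        (c.subset_apply t d htd)
      by_cases ha : c.involves a
      · have had := involves_of_mem_three h3 hl.1 hn.1 ha
        rw [trace_cons_of_involves ha, trace_cons_of_involves ha, this, had.apply, had.apply,
          hfull hs hsa hsb hsd, hfull ht hta htb htd]
      · rw [trace_cons_of_not_involves ha, trace_cons_of_not_involves ha, this]

/-- If `a` makes the first call, then `a` learns the secret of `b` only through a call in which
`b` learns the secret of `a`. -/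
lemma FirstBy.mem_or_notMem (F : Frame U a b d ν) (h3 : ∀ e ∈ U, e = a ∨ e = b ∨ e = d)
    (h : FirstBy U b a σ) (hn : ∀ c ∈ σ, ¬ c.isBetween a b)
    (hu : applySeq σ root a ∪ applySeq σ root b = U) :
    a ∈ applySeq σ root b ∨ b ∉ applySeq σ root a := by
  have hw := within_restrict U σ
  have hn' := not_isBetween_restrict (U := U) hn
  rw [← (restrict_of_joint hu).1, ← (restrict_of_joint hu).2]
  obtain ⟨ρ, c₁, l, h, hρb, -, hc₁⟩ := h
  rw [h] at hw hn' ⊢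
  have had : c₁.isBetween a d :=
    involves_of_mem_three h3 (hw c₁ (by simp)) (hn' c₁ (by simp)) hc₁
  have hbefore : ∀ c ∈ ρ ++ [c₁], ¬ c.involves b := by
    intro c hc hcb
    rcases List.mem_append.1 hc with hc | hc
    · exact hρb c hc hcb
    · obtain rfl := List.mem_singleton.1 hc
      exact hn' c (by simp) (Call.isBetween_of_involves F.ne hc₁ hcb)
  have hstart := notMem_applySeq_of_not_involves hbefore (s := root)
    fun e he => by simpa [root] using he.symm
  suffices a ∈ applySeq (ρ ++ [c₁] ++ l) root d ∧ (a ∈ applySeq (ρ ++ [c₁] ++ l) root b ∨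
      b ∉ applySeq (ρ ++ [c₁] ++ l) root a ∧ b ∉ applySeq (ρ ++ [c₁] ++ l) root d) from
    this.2.imp_right And.left
  clear h
  induction l using List.reverseRecOn with
  | nil =>
    rw [List.append_nil]
    exact ⟨subset_applySeq_of_mem (c := c₁) (d := a) (by simp) hc₁ had.right
      (Finset.mem_singleton_self _), Or.inr ⟨hstart a F.ne, hstart d F.ne_b.symm⟩⟩
  | append_singleton l c ih =>
    rw [← List.append_assoc] at hw hn' ⊢
    obtain ⟨hd, h⟩ := ih (fun c hc => hn' c (List.mem_append_left _ hc))
      fun c hc => hw c (List.mem_append_left _ hc)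
    have hcU := hw c (by simp)
    have hcn := hn' c (by simp)
    rw [applySeq_append _ [c]]
    generalize applySeq (ρ ++ [c₁] ++ l) root = s at hd h
    refine ⟨c.subset_apply s d hd, ?_⟩
    change a ∈ c.apply s b ∨ b ∉ c.apply s a ∧ b ∉ c.apply s d
    by_cases hb : c.involves b
    · have hbd : c.isBetween b d :=
        involves_of_mem_three (fun e he => by have := h3 e he; tauto) hcU
          (fun h => hcn h.symm) hb
      rw [hbd.apply]
      exact Or.inl (Finset.mem_union_right _ hd)
    · rw [Call.apply_of_not_involves hb]
      refine h.imp_right fun h => ?_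
      by_cases ha : c.involves a
      · have hcd := involves_of_mem_three h3 hcU hcn ha
        rw [hcd.apply, hcd.symm.apply]
        simp [h.1, h.2]
      · have hd' : ¬ c.involves d := by
          intro hd'
          have hne := c.ne
          have hx := h3 _ hcU.1
          have hy := h3 _ hcU.2
          unfold Call.involves at ha hb hd'
          grind
        rwa [Call.apply_of_not_involves ha, Call.apply_of_not_involves hd']

lemma FirstBy.linked_of_pairView_eq (F : Frame U a b d ν) (hc : c.isBetween a b)
    (h3 : ∀ e ∈ U, e = a ∨ e = b ∨ e = d) (hσ : FirstBy U a b σ) (hτ : FirstBy U b a τ)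
    (hσn : ∀ c ∈ σ, ¬ c.isBetween a b) (hτn : ∀ c ∈ τ, ¬ c.isBetween a b)
    (hσu : applySeq σ root a ∪ applySeq σ root b = U)
    (hτu : applySeq τ root a ∪ applySeq τ root b = U)
    (hs : applySeq σ root a = applySeq τ root a) (hv : pairView σ a a = pairView τ a a) :
    Linked a b c σ τ := by
  have hlink := hσ.linked F hc hσu hσn
  obtain ⟨ρ, c₁, l, h, hρa, hρb, hc₁⟩ := hσ
  have hw := within_restrict U σ
  have hn := not_isBetween_restrict (U := U) hσn
  have hσr := agEquiv_restrict (σ := σ) (a := a) (U := U) (hσu ▸ Finset.subset_union_left)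
  rw [h] at hw hn hσr
  have hbd : c₁.isBetween b d :=
    involves_of_mem_three (fun e he => by have := h3 e he; tauto) (hw c₁ (by simp))
      (fun h => hn c₁ (by simp) h.symm) hc₁
  have hc₁a : ¬ c₁.involves a := fun ha =>
    hn c₁ (by simp) (Call.isBetween_of_involves F.ne ha hc₁)
  have hwρ : Within U (ρ ++ [c₁]) := fun c hc => hw c (List.mem_append_left _ hc)
  have hbs : b ∈ applySeq (ρ ++ [c₁]) root d :=
    subset_applySeq_of_mem (c := c₁) (d := b) (by simp) hc₁ hbd.right
      (Finset.mem_singleton_self _)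
  obtain ⟨π, hπ⟩ : ∃ π, π = ρ ++ [c₁] ++ l.filter fun c => ¬ c.involves b := ⟨_, rfl⟩
  have hσπ : AgEquiv a σ π := by
    refine hσr.trans (agEquiv_iff_trace_eq.2 ?_)
    rw [hπ, trace_append (ρ ++ [c₁]) l, trace_append (ρ ++ [c₁])]
    congr 1
    exact trace_filter_not_involves F h3 (fun c hc => hw c (List.mem_append_right _ hc))
      (fun c hc => hn c (List.mem_append_right _ hc)) (fun _ => hwρ.subset)
      (fun _ => hwρ.subset) (self_mem_applySeq _ _) (self_mem_applySeq _ _) hbs hbs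
      (self_mem_applySeq _ _) (self_mem_applySeq _ _)
  have hπw : Within U π := by
    rw [hπ]
    exact hwρ.append fun c hc => hw c (List.mem_append_right _ (List.mem_filter.1 hc).1)
  have hπb : applySeq π root b = applySeq (ρ ++ [c₁]) root b := by
    rw [hπ, applySeq_append, applySeq_of_not_involves fun c hc => by
      simpa using (List.mem_filter.1 hc).2]
  have haπ : a ∉ applySeq π root b := by
    rw [hπb]
    refine notMem_applySeq_of_not_involves (fun c hc => ?_)
      (fun e he => by simpa [root] using he.symm) b F.ne.symm
    rcases List.mem_append.1 hc with hc | hc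
    · exact hρa c hc
    · rwa [List.mem_singleton.1 hc]
  have hdπ : d ∈ applySeq π root b := by
    rw [hπb]
    exact subset_applySeq_of_mem (c := c₁) (d := d) (by simp) hbd.right hc₁
      (Finset.mem_singleton_self _)
  have hπu : applySeq π root a ∪ applySeq π root b = U := by
    refine subset_antisymm (Finset.union_subset (hπw.subset F.mem_a) (hπw.subset F.mem_b))
      fun e he => ?_
    rcases h3 e he with rfl | rfl | rfl
    · exact Finset.mem_union_left _ (self_mem_applySeq _ _)
    · exact Finset.mem_union_right _ (self_mem_applySeq _ _)
    · exact Finset.mem_union_right _ hdπ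
  have hmem : applySeq π root ∈ pairView τ a a := by
    rw [← hv]
    exact ⟨π, gEquiv_singleton_iff.2 hσπ, rfl⟩
  obtain ⟨π', hτπ', hππ'⟩ := hmem
  rw [gEquiv_singleton_iff] at hτπ'
  have hπ'u : applySeq π' root a ∪ applySeq π' root b = U := by rw [← hππ', hπu]
  have hπ'n : ∀ c ∈ π', ¬ c.isBetween a b :=
    (hτπ'.gEquiv (G := {a, b}) (by simp)).not_isBetween hτn
  have hlink' : Linked a b c π' τ := (hτπ'.linked hc (Or.inl rfl) (hτu.trans hπ'u.symm)).symm
  rcases firstBy_or_firstBy F hπ'u with h' | h'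
  · exact hlink.trans ((h'.linked F hc hπ'u hπ'n).symm.trans hlink')
  exfalso
  rcases h'.mem_or_notMem F h3 hπ'n hπ'u with hab | hba
  · exact haπ (hππ' ▸ hab)
  refine hba ?_
  rw [← hτπ'.applySeq_eq, ← hs]
  have hda : d ∈ applySeq (ρ ++ [c₁] ++ l) root a := by
    rw [← h, (restrict_of_joint hσu).1, hs, ← (restrict_of_joint hτu).1]
    have hwτ := within_restrict U τ
    have hnτ := not_isBetween_restrict (U := U) hτn
    obtain ⟨ρ', c₂, l', h₂, -, -, hc₂⟩ := hτ
    rw [h₂] at hwτ hnτ ⊢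
    have hcd := involves_of_mem_three h3 (hwτ c₂ (by simp)) (hnτ c₂ (by simp)) hc₂
    exact subset_applySeq_of_mem (c := c₂) (d := d) (by simp) hcd.right hc₂
      (Finset.mem_singleton_self _)
  have hcall : ∃ c ∈ l, c.involves a := by
    by_contra! hl
    rw [applySeq_append, applySeq_of_not_involves hl, applySeq_append,
      applySeq_of_not_involves (l := [c₁]) (by simpa using hc₁a),
      applySeq_of_not_involves hρa] at hda
    exact F.ne_a (Finset.mem_singleton.1 hda).symm
  obtain ⟨c₂, hc₂, hc₂a⟩ := hcall
  have hcd := involves_of_mem_three h3 (hw c₂ (by simp [hc₂])) (hn c₂ (by simp [hc₂])) hc₂a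
  rw [← (restrict_of_joint hσu).1, h, applySeq_append]
  exact subset_applySeq_of_mem hc₂ hcd.right hc₂a hbs

lemma linked_of_pairView_eq (hab : a ≠ b) (hc : c.isBetween a b)
    (hσn : ∀ c ∈ σ, ¬ c.isBetween a b) (hτn : ∀ c ∈ τ, ¬ c.isBetween a b)
    (hs : applySeq σ root = applySeq τ root) (hv : pairView σ a a = pairView τ a a) :
    Linked a b c σ τ := by
  obtain ⟨U, hσu⟩ : ∃ U, applySeq σ root a ∪ applySeq σ root b = U := ⟨_, rfl⟩
  have hτu : applySeq τ root a ∪ applySeq τ root b = U := by rw [← hs, hσu]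
  by_cases hd : ∃ d ∈ U, d ≠ a ∧ d ≠ b
  swap
  · refine linked_of_joint_eq_pair hc (fun d hdU => ?_) hσu hτu ?_
    · by_contra! hne
      exact hd ⟨d, hdU, hne⟩
    · rw [List.filter_eq_nil_iff.2 (by simpa using hσn),
        List.filter_eq_nil_iff.2 (by simpa using hτn)]
  obtain ⟨d, hd, hda, hdb⟩ := hd
  obtain ⟨ν, F⟩ := exists_frame (mem_joint_left hσu) (mem_joint_right hσu) hd hab hda.symm
    hdb.symm
  have hright : ∀ {σ}, FirstBy U b a σ → applySeq σ root a ∪ applySeq σ root b = U →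
      (∀ c ∈ σ, ¬ c.isBetween a b) → Linked a b c σ (F.symm.close []) := fun h hu hn =>
    (h.linked F.symm hc.symm (by rwa [Finset.union_comm]) fun c hc h => hn c hc h.symm).swap
  by_cases h3 : ∀ e ∈ U, e = a ∨ e = b ∨ e = d
  · rcases firstBy_or_firstBy F hσu with h | h <;> rcases firstBy_or_firstBy F hτu with h' | h'
    · exact (h.linked F hc hσu hσn).trans (h'.linked F hc hτu hτn).symm
    · exact h.linked_of_pairView_eq F hc h3 h' hσn hτn hσu hτu (congrFun hs a) hv
    · exact (h'.linked_of_pairView_eq F hc h3 h hτn hσn hτu hσu (congrFun hs a).symm hv.symm).symm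
    · exact (hright h hσu hσn).trans (hright h' hτu hτn).symm
  · push Not at h3
    obtain ⟨e, he, hea, heb, hed⟩ := h3
    have hswap := F.linked_close_nil_symm hc he hea.symm heb.symm hed
    have key : ∀ {σ}, applySeq σ root a ∪ applySeq σ root b = U →
        (∀ c ∈ σ, ¬ c.isBetween a b) → Linked a b c σ (F.close []) := fun hu hn =>
      (firstBy_or_firstBy F hu).elim (fun h => h.linked F hc hu hn)
        fun h => (hright h hu hn).trans hswap.symm
    exact (key hσu hσn).trans (key hτu hτn).symm

end Joint

/-! ### Epistemic pair-views after a further call -/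

section View

variable {a b : A} {c : Call A} {σ τ : List (Call A)}

lemma pairView_concat_self_subset (ha : c.involves a) (hs : applySeq σ root = applySeq τ root)
    (hv : pairView σ a a = pairView τ a a) :
    pairView (σ ++ [c]) a a ⊆ pairView (τ ++ [c]) a a := by
  rintro _ ⟨χ, hχ, rfl⟩
  rw [gEquiv_singleton_iff] at hχ
  obtain ⟨χ', l, rfl, h, hl⟩ := hχ.exists_of_concat ha
  have hmem : applySeq χ' root ∈ pairView τ a a :=
    hv ▸ ⟨χ', gEquiv_singleton_iff.2 h, rfl⟩
  obtain ⟨τ', hτ', hs'⟩ := hmem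
  rw [gEquiv_singleton_iff] at hτ'
  have hχl := hχ.applySeq_eq
  rw [applySeq_append (_ ++ _), applySeq_of_not_involves hl] at hχl
  refine ⟨τ' ++ [c] ++ l, gEquiv_singleton_iff.2 (AgEquiv.append_right (.call c ha ?_ hτ') hl), ?_⟩
  · simp only [applySeq_append] at hχl ⊢
    rw [← hs, ← hs', hχl]
  · simp only [applySeq_append, hs']

lemma exists_isBetween_of_pairView_eq (hab : a ≠ b) (hv : pairView σ a b = pairView τ a b)
    (hσ : ∃ c ∈ σ, c.isBetween a b) : ∃ c ∈ τ, c.isBetween a b := by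
  by_contra! hτ
  have hmem : root ∈ pairView τ a b := ⟨[], (gEquiv_append (σ := []) hab hτ).symm, rfl⟩
  rw [← hv] at hmem
  obtain ⟨χ, hχ, hs⟩ := hmem
  obtain ⟨c, hc, hcab⟩ := hχ.exists_isBetween hσ
  have : a ∈ applySeq χ root b :=
    subset_applySeq_of_mem hc hcab.left hcab.right (Finset.mem_singleton_self a)
  rw [← hs] at this
  exact hab (Finset.mem_singleton.1 this)

lemma pairView_concat_subset (hab : a ≠ b) (hc : c.isBetween a b)
    (hk : ∃ c ∈ τ, c.isBetween a b) (hs : applySeq σ root = applySeq τ root)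
    (hv : pairView σ a b = pairView τ a b) :
    pairView (σ ++ [c]) a b ⊆ pairView (τ ++ [c]) a b := by
  rintro _ ⟨χ, hχ, rfl⟩
  obtain ⟨χ', hcore, h, hu⟩ := hχ.exists_core_eq_concat hc
  obtain ⟨m, hm, hm'⟩ := exists_eq_core_append a b χ
  have hmem : applySeq χ' root ∈ pairView τ a b := hv ▸ ⟨χ', h, rfl⟩
  obtain ⟨τ', hτ', hs'⟩ := hmem
  rw [hcore] at hm
  have hl : Linked a b c τ τ' := hτ'.linked hab hc hk (by rw [← hs, ← hs', hu])
  refine ⟨τ' ++ [c] ++ m, Relation.ReflTransGen.trans hl (gEquiv_append hab hm'), ?_⟩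
  rw [hm]
  simp only [applySeq_append, hs']

lemma fullView_concat_eq (h : fullView σ = fullView τ) (c : Call A) :
    fullView (σ ++ [c]) = fullView (τ ++ [c]) := by
  have hs : applySeq σ root = applySeq τ root := congrArg Prod.snd h
  have hv : ∀ a b, pairView σ a b = pairView τ a b := fun a b =>
    congrFun (congrFun (congrArg Prod.fst h) a) b
  have hout : ∀ a b, ¬ c.involves a → pairView (σ ++ [c]) a b = pairView (τ ++ [c]) a b := by
    intro a b ha
    have key : ∀ υ : List (Call A), pairView (υ ++ [c]) a b = pairView υ a b := fun υ =>
      ((AgEquiv.extLeft c ha (.refl a υ)).gEquiv (by simp)).pairView_eq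
    rw [key, key, hv]
  refine Prod.ext (funext₂ fun a b => ?_) ?_
  · change pairView (σ ++ [c]) a b = pairView (τ ++ [c]) a b
    by_cases ha : c.involves a
    swap
    · exact hout a b ha
    by_cases hb : c.involves b
    swap
    · rw [pairView_comm _ a, pairView_comm _ a]
      exact hout b a hb
    by_cases hab : a = b
    · subst hab
      exact subset_antisymm (pairView_concat_self_subset ha hs (hv a a))
        (pairView_concat_self_subset ha hs.symm (hv a a).symm)
    have hc := Call.isBetween_of_involves hab ha hb
    by_cases hk : ∃ c ∈ σ, c.isBetween a b
    · exact subset_antisymm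
        (pairView_concat_subset hab hc (exists_isBetween_of_pairView_eq hab (hv a b) hk) hs
          (hv a b))
        (pairView_concat_subset hab hc hk hs.symm (hv a b).symm)
    · have hk' : ¬ ∃ c ∈ τ, c.isBetween a b := fun hk' =>
        hk (exists_isBetween_of_pairView_eq hab (hv a b).symm hk')
      push Not at hk hk'
      exact GEquiv.pairView_eq (linked_of_pairView_eq hab hc hk hk' hs (hv a a))
  · change applySeq (σ ++ [c]) root = applySeq (τ ++ [c]) root
    rw [applySeq_append, applySeq_append, hs]

end View

theorem stmt14 {A : Type} [DecidableEq A] [Fintype A] (hA : 3 ≤ Fintype.card A)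
    (σ₁ σ₂ σ₃ : List (Call A)) (h : fullView σ₁ = fullView (σ₁ ++ σ₂)) :
    fullView (σ₁ ++ σ₂ ++ σ₃) = fullView (σ₁ ++ σ₃) := by
  induction σ₃ using List.reverseRecOn with
  | nil => rw [List.append_nil, List.append_nil, h]
  | append_singleton σ₃ c ih =>
    rw [← List.append_assoc, ← List.append_assoc]
    exact fullView_concat_eq ih c

end Gossip
end

section
/- The set of pair-epistemically non-redundant call sequences is finite. More precisely, every pair-epistemically non-redundant call sequence has length at most 2^{(|A|²+1)·2^{|A|·|P|}}, and consequently there are only finitely many of them. -/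
namespace Gossip

variable {A : Type} [DecidableEq A]

instance [Finite A] : Finite (Call A) :=
  Finite.of_injective (fun c : Call A => (c.x, c.y)) fun c d h => by
    cases c
    cases d
    simpa using h

/-- Distinct prefixes of a non-redundant sequence have distinct pair-views. -/
theorem PairNonRedundant.injective_fullView_take {σ : List (Call A)} (hσ : PairNonRedundant σ) :
    Function.Injective fun i : Fin (σ.length + 1) => fullView (σ.take i) := by
  have key : ∀ i j : ℕ, i < j → j ≤ σ.length → fullView (σ.take i) ≠ fullView (σ.take j) := by
    intro i j hij hj
    have hsplit : σ.take i ++ (σ.take j).drop i = σ.take j := by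
      have h := List.take_append_drop i (σ.take j)
      rwa [List.take_take, min_eq_left hij.le] at h
    have h := hσ (σ.take i) ((σ.take j).drop i) (by rw [hsplit]; exact List.take_prefix j σ)
      (by
        apply List.ne_nil_of_length_pos
        rw [List.length_drop, List.length_take]
        omega)
    rwa [hsplit] at h
  intro i j hij
  rcases lt_trichotomy (i : ℕ) (j : ℕ) with h | h | h
  · exact absurd hij (key i j h (by omega))
  · exact Fin.ext h
  · exact absurd hij.symm (key j i h (by omega))

/-- The number of conceivable full pair-views. -/
theorem card_fullView_codomain [Fintype A] :
    Nat.card ((A → A → Set (A → Finset A)) × (A → Finset A)) =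
      2 ^ (Fintype.card A ^ 2 * 2 ^ (Fintype.card A * Fintype.card A) +
        Fintype.card A * Fintype.card A) := by
  classical
  rw [Nat.card_eq_fintype_card]
  simp only [Fintype.card_prod, Fintype.card_fun, Fintype.card_set, Fintype.card_finset]
  rw [← pow_mul, ← pow_mul, ← pow_mul, ← pow_add]
  congr 1
  ring

theorem PairNonRedundant.length_le [Fintype A] {σ : List (Call A)} (hσ : PairNonRedundant σ) :
    σ.length ≤ 2 ^ ((Fintype.card A ^ 2 + 1) * 2 ^ (Fintype.card A * Fintype.card A)) := by
  have h := Nat.card_le_card_of_injective _ hσ.injective_fullView_take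
  rw [Nat.card_fin, card_fullView_codomain] at h
  refine (Nat.le_succ _).trans (h.trans (Nat.pow_le_pow_right two_pos ?_))
  rw [add_mul, one_mul]
  exact Nat.add_le_add_left Nat.lt_two_pow_self.le _

theorem stmt16 {A : Type} [DecidableEq A] [Fintype A] (hA : 3 ≤ Fintype.card A) :
    {σ : List (Call A) | PairNonRedundant σ}.Finite ∧
    ∀ σ : List (Call A), PairNonRedundant σ →
      σ.length ≤ 2 ^ ((Fintype.card A ^ 2 + 1) * 2 ^ (Fintype.card A * Fintype.card A)) := by
  refine ⟨?_, fun σ hσ => hσ.length_le⟩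
  exact (List.finite_length_le (Call A) _).subset fun σ hσ => PairNonRedundant.length_le hσ

end Gossip
end
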